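/- Suppose (A,B) is controllable, {u_k^d, y_k^d}_{k=0}^{N-1} is a trajectory of the LTI system, and u^d is persistently exciting of order L + n' for some integer n' ≥ n. Then {ū_k, ȳ_k}_{k=0}^{L-1} is a trajectory of the LTI system if and only if there exists α ∈ ℝ^{N−L+1} such that, in stacked form, H_L(u^d)α = ū and H_L(y^d)α = ȳ; i.e., the fundamental lemma remains true when the true system order n is replaced by any upper bound n' on it. -/

import Mathlib

open Matrix

noncomputable section

/-- Hankel matrix of depth `L` of the sequence `u : {0,…,N-1} → ℝ^m`:
the block in block-row `i` and column `j` is `u (i+j)`. -/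
def Hankel (m N L : ℕ) (u : ℕ → Fin m → ℝ) :
    Matrix (Fin L × Fin m) (Fin (N - L + 1)) ℝ :=
  Matrix.of fun ik j => u ((ik.1 : ℕ) + (j : ℕ)) ik.2

/-- The sequence `u` (of length `N`) is persistently exciting of order `L`. -/
def PersistentlyExciting (m N L : ℕ) (u : ℕ → Fin m → ℝ) : Prop :=
  (Hankel m N L u).rank = m * L

/-- `{u_k, y_k}_{k=0}^{L-1}` is a trajectory of the LTI system `(A,B,C,D)`. -/
def IsTrajectory (n m p L : ℕ) (A : Matrix (Fin n) (Fin n) ℝ)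
    (B : Matrix (Fin n) (Fin m) ℝ) (C : Matrix (Fin p) (Fin n) ℝ)
    (D : Matrix (Fin p) (Fin m) ℝ) (u : ℕ → Fin m → ℝ) (y : ℕ → Fin p → ℝ) : Prop :=
  ∃ x : ℕ → Fin n → ℝ, ∀ k < L,
    x (k + 1) = A.mulVec (x k) + B.mulVec (u k) ∧
    y k = C.mulVec (x k) + D.mulVec (u k)

/-- `(A,B)` is controllable: `rank [B, AB, …, A^{n-1}B] = n`. -/
def Controllable (n m : ℕ) (A : Matrix (Fin n) (Fin n) ℝ)
    (B : Matrix (Fin n) (Fin m) ℝ) : Prop :=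
  (Matrix.of fun i (kj : Fin n × Fin m) => ((A ^ (kj.1 : ℕ)) * B) i kj.2).rank = n

/-- `(A,C)` is observable: `rank [C; CA; …; CA^{n-1}] = n`. -/
def Observable (n p : ℕ) (A : Matrix (Fin n) (Fin n) ℝ)
    (C : Matrix (Fin p) (Fin n) ℝ) : Prop :=
  (Matrix.of fun (ki : Fin n × Fin p) j => (C * A ^ (ki.1 : ℕ)) ki.2 j).rank = n

/-- A matrix whose rank is its number of rows has trivial left kernel. -/
theorem Matrix.eq_zero_of_vecMul_eq_zero_of_rank {ι κ K : Type*} [Fintype ι] [Fintype κ] [Field K]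
    {M : Matrix ι κ K} (hM : M.rank = Fintype.card ι) {c : ι → K} (hc : c ᵥ* M = 0) : c = 0 := by
  have hli : LinearIndependent K M.row := by
    rw [linearIndependent_iff_card_eq_finrank_span, ← hM, rank_eq_finrank_span_row]
    rfl
  exact Matrix.vecMul_injective_iff.2 hli (by simpa using hc)

/-- A matrix with trivial left kernel is surjective as a linear map. -/
theorem Matrix.mulVec_surjective_of_vecMul_eq_zero {ι κ K : Type*} [Fintype ι] [Fintype κ] [Field K]
    {M : Matrix ι κ K} (hM : ∀ c : ι → K, c ᵥ* M = 0 → c = 0) :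
    Function.Surjective M.mulVec := by
  have hli : LinearIndependent K M.row := by
    rw [← Matrix.vecMul_injective_iff]
    intro c d hcd
    exact sub_eq_zero.1 (hM _ (by rw [Matrix.sub_vecMul]; exact sub_eq_zero.2 hcd))
  have hr := hli.rank_matrix
  have htop : LinearMap.range M.mulVecLin = ⊤ :=
    Submodule.eq_top_of_finrank_eq (by simpa [Matrix.rank] using hr)
  exact LinearMap.range_eq_top.1 htop

/-- Every matrix is annihilated by a monic polynomial of any degree at least its size. -/
theorem Matrix.exists_monic_aeval_eq_zero {R : Type*} [CommRing R] [Nontrivial R] {n d : ℕ}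
    (hd : n ≤ d) (A : Matrix (Fin n) (Fin n) R) :
    ∃ q : ℕ → R, q d = 1 ∧ ∑ k ∈ Finset.range (d + 1), q k • A ^ k = 0 := by
  have hmon : (Polynomial.X ^ (d - n) * A.charpoly).Monic :=
    (Polynomial.monic_X_pow _).mul A.charpoly_monic
  have hdeg : (Polynomial.X ^ (d - n) * A.charpoly).natDegree = d := by
    rw [(Polynomial.monic_X_pow _).natDegree_mul A.charpoly_monic, Polynomial.natDegree_X_pow,
      A.charpoly_natDegree_eq_dim, Fintype.card_fin]
    omega
  refine ⟨(Polynomial.X ^ (d - n) * A.charpoly).coeff, ?_, ?_⟩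
  · rw [← hmon.coeff_natDegree, hdeg]
  · have h := Polynomial.aeval_eq_sum_range (p := Polynomial.X ^ (d - n) * A.charpoly) A
    rw [hdeg, map_mul, A.aeval_self_charpoly, mul_zero] at h
    exact h.symm

/-- A sequence vanishes on an initial segment if a suitable monic recursion does. -/
theorem eq_zero_of_monic_recursion {R E : Type*} [Semiring R] [AddCommMonoid E] [Module R E]
    {d M : ℕ} {q : ℕ → R} (hq : q d = 1) {h : ℕ → E}
    (hrec : ∀ s < M, ∑ k ∈ Finset.range (d + 1),
      q k • (if d ≤ s + k then h (s + k - d) else 0) = 0) :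
    ∀ s < M, h s = 0 := by
  intro s
  induction s using Nat.strong_induction_on with
  | _ s ih =>
    intro hs
    have h0 := hrec s hs
    rw [Finset.sum_range_succ, Finset.sum_eq_zero, hq] at h0
    · simpa using h0
    · intro k hk
      have hkd := Finset.mem_range.1 hk
      split_ifs with hle
      · rw [ih _ (by omega) (by omega), smul_zero]
      · exact smul_zero _

/-- Shifting a linear relation between the state and a window of inputs along a trajectory. -/
theorem state_input_relation_shift {n m N L : ℕ} {A : Matrix (Fin n) (Fin n) ℝ}
    {B : Matrix (Fin n) (Fin m) ℝ} {u : ℕ → Fin m → ℝ} {x : ℕ → Fin n → ℝ}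
    (hx : ∀ k < N, x (k + 1) = A *ᵥ x k + B *ᵥ u k) {ξ : Fin n → ℝ} {h : ℕ → Fin m → ℝ}
    (hh : ∀ k, h (L + k) = (ξ ᵥ* A ^ k) ᵥ* B)
    (h0 : ∀ j, j + L ≤ N → ∑ i ∈ Finset.range L, h (L - 1 - i) ⬝ᵥ u (j + i) + ξ ⬝ᵥ x j = 0)
    (k : ℕ) : ∀ j, j + (L + k) ≤ N →
      ∑ i ∈ Finset.range (L + k), h (L + k - 1 - i) ⬝ᵥ u (j + i) + (ξ ᵥ* A ^ k) ⬝ᵥ x j = 0 := by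
  induction k with
  | zero => simpa using h0
  | succ k ih =>
    intro j hj
    have h1 := ih (j + 1) (by omega)
    rw [hx j (by omega), dotProduct_add, dotProduct_mulVec, dotProduct_mulVec, vecMul_vecMul,
      ← pow_succ, ← hh] at h1
    rw [← add_assoc, Finset.sum_range_succ', add_zero]
    have hs : ∀ i ∈ Finset.range (L + k), h (L + k + 1 - 1 - (i + 1)) ⬝ᵥ u (j + (i + 1)) =
        h (L + k - 1 - i) ⬝ᵥ u (j + 1 + i) := by
      intro i _
      congr 2 <;> omega
    rw [Finset.sum_congr rfl hs]
    have : L + k + 1 - 1 - 0 = L + k := by omega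
    rw [this]
    linarith

/-- A linear relation between consecutive inputs of a persistently exciting sequence is trivial. -/
theorem PersistentlyExciting.eq_zero {m N L : ℕ} {u : ℕ → Fin m → ℝ}
    (hu : PersistentlyExciting m N L u) {c : ℕ → Fin m → ℝ}
    (hc : ∀ j < N - L + 1, ∑ i ∈ Finset.range L, c i ⬝ᵥ u (j + i) = 0) :
    ∀ i < L, c i = 0 := by
  have hz : (fun r : Fin L × Fin m => c r.1 r.2) = 0 := by
    refine Matrix.eq_zero_of_vecMul_eq_zero_of_rank (M := Hankel m N L u) ?_ ?_
    · rw [hu, Fintype.card_prod, Fintype.card_fin, Fintype.card_fin, mul_comm]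
    · ext j
      have := hc j j.2
      rw [Finset.sum_range] at this
      simpa [vecMul, dotProduct, Hankel, Fintype.sum_prod_type, add_comm] using this
  intro i hi
  ext a
  exact congrFun hz (⟨i, hi⟩, a)

/-- A functional annihilating all `A ^ k * B` of a controllable pair is zero. -/
theorem Controllable.eq_zero {n m : ℕ} {A : Matrix (Fin n) (Fin n) ℝ}
    {B : Matrix (Fin n) (Fin m) ℝ} (hAB : Controllable n m A B) {ξ : Fin n → ℝ}
    (hξ : ∀ k < n, (ξ ᵥ* A ^ k) ᵥ* B = 0) : ξ = 0 := by
  refine Matrix.eq_zero_of_vecMul_eq_zero_of_rank (hAB.trans (Fintype.card_fin n).symm) ?_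
  ext ⟨k, a⟩
  have := congrFun (hξ k k.2) a
  rw [vecMul_vecMul] at this
  exact this

/-- For a controllable system with persistently exciting input, the initial state and the
input window can be prescribed simultaneously. -/
theorem surjective_state_input {n n' m N L : ℕ} {A : Matrix (Fin n) (Fin n) ℝ}
    {B : Matrix (Fin n) (Fin m) ℝ} (hAB : Controllable n m A B) (hn' : n ≤ n')
    {u : ℕ → Fin m → ℝ} {x : ℕ → Fin n → ℝ}
    (hx : ∀ k < N, x (k + 1) = A *ᵥ x k + B *ᵥ u k) (hLN : L + n' ≤ N)
    (hu : PersistentlyExciting m N (L + n') u) :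
    Function.Surjective (fromRows (Matrix.of fun i (j : Fin (N - L + 1)) => x j i)
      (Hankel m N L u)).mulVec := by
  refine Matrix.mulVec_surjective_of_vecMul_eq_zero fun c hc => ?_
  set ξ : Fin n → ℝ := fun i => c (Sum.inl i)
  -- The input coefficients of the relation in reversed order, followed by those that appear
  -- when the relation is shifted.
  let h : ℕ → Fin m → ℝ := fun s =>
    if hs : s < L then fun a => c (Sum.inr (⟨L - 1 - s, by omega⟩, a))
    else (ξ ᵥ* A ^ (s - L)) ᵥ* B
  have hhL : ∀ k, h (L + k) = (ξ ᵥ* A ^ k) ᵥ* B := by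
    intro k
    simp [h]
  have hlow : ∀ i : Fin L, h (L - 1 - i) = fun a => c (Sum.inr (i, a)) := by
    intro i
    have hi := i.2
    have h1 : L - 1 - (i : ℕ) < L := by omega
    have h2 : L - 1 - (L - 1 - (i : ℕ)) = i := by omega
    simp [h, h1, h2]
  have h0 : ∀ j, j + L ≤ N →
      ∑ i ∈ Finset.range L, h (L - 1 - i) ⬝ᵥ u (j + i) + ξ ⬝ᵥ x j = 0 := by
    intro j hj
    have hcj := congrFun hc (⟨j, by omega⟩ : Fin (N - L + 1))
    rw [Finset.sum_range]
    simp only [hlow]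
    simpa [vecMul, dotProduct, Hankel, Fintype.sum_prod_type, add_comm, ξ] using hcj
  have hshift := state_input_relation_shift hx hhL h0
  obtain ⟨q, hq1, hqA⟩ := Matrix.exists_monic_aeval_eq_zero hn' A
  let K : ℕ → ℕ → Fin m → ℝ := fun k i => if i < L + k then h (L + k - 1 - i) else 0
  have hcoeff : ∀ i < L + n', ∑ k ∈ Finset.range (n' + 1), q k • K k i = 0 := by
    refine hu.eq_zero fun j hj => ?_
    have hK : ∀ k ∈ Finset.range (n' + 1), q k * ∑ i ∈ Finset.range (L + n'), K k i ⬝ᵥ u (j + i) =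
        -((ξ ᵥ* (q k • A ^ k)) ⬝ᵥ x j) := by
      intro k hk
      have hk' := Finset.mem_range.1 hk
      rw [← Finset.sum_subset (Finset.range_subset_range.2 (by omega : L + k ≤ L + n'))]
      · rw [vecMul_smul, smul_dotProduct, smul_eq_mul, ← mul_neg,
          ← eq_neg_of_add_eq_zero_left (hshift k j (by omega))]
        congr 1
        refine Finset.sum_congr rfl fun i hi => ?_
        simp [K, Finset.mem_range.1 hi]
      · intro i _ hi
        have : ¬ i < L + k := by simpa using hi
        simp [K, this]
    simp only [sum_dotProduct, smul_dotProduct, smul_eq_mul]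
    rw [Finset.sum_comm]
    simp only [← Finset.mul_sum]
    rw [Finset.sum_congr rfl hK, Finset.sum_neg_distrib, ← sum_dotProduct, ← vecMul_sum, hqA]
    simp
  have hzero : ∀ s < L + n', h s = 0 := by
    refine eq_zero_of_monic_recursion hq1 fun s hs => ?_
    refine Eq.trans ?_ (hcoeff (L + n' - 1 - s) (by omega))
    refine Finset.sum_congr rfl fun k hk => ?_
    have hk' := Finset.mem_range.1 hk
    by_cases hle : n' ≤ s + k
    · have h1 : L + n' - 1 - s < L + k := by omega
      have h2 : L + k - 1 - (L + n' - 1 - s) = s + k - n' := by omega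
      simp only [K, if_pos hle, if_pos h1, h2]
    · have h1 : ¬ L + n' - 1 - s < L + k := by omega
      simp only [K, if_neg hle, if_neg h1]
  have hξ0 : ξ = 0 := hAB.eq_zero fun k hk => by rw [← hhL]; exact hzero _ (by omega)
  ext (i | ⟨i, a⟩)
  · exact congrFun hξ0 i
  · have := congrFun (hlow i) a
    rw [hzero _ (by omega)] at this
    exact this.symm

/-- Linear combinations commute with the map `(v, w) ↦ F v + G w`. -/
theorem Matrix.sum_smul_mulVec_add {ι κ l r : Type*} [Fintype ι] [Fintype l] [Fintype r]
    (F : Matrix κ l ℝ) (G : Matrix κ r ℝ) (α : ι → ℝ) (v : ι → l → ℝ) (w : ι → r → ℝ) :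
    ∑ j, α j • (F *ᵥ v j + G *ᵥ w j) = F *ᵥ (∑ j, α j • v j) + G *ᵥ (∑ j, α j • w j) := by
  simp only [mulVec_sum, mulVec_smul, smul_add, Finset.sum_add_distrib]

/-- The fundamental lemma remains true when the true system order `n` is replaced by
any upper bound `n' ≥ n` on it. -/
theorem fundamental_lemma_upper_bound (n n' m p N L : ℕ)
    (A : Matrix (Fin n) (Fin n) ℝ) (B : Matrix (Fin n) (Fin m) ℝ)
    (C : Matrix (Fin p) (Fin n) ℝ) (D : Matrix (Fin p) (Fin m) ℝ)
    (hctrb : Controllable n m A B)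
    (hn' : n ≤ n')
    (ud : ℕ → Fin m → ℝ) (yd : ℕ → Fin p → ℝ)
    (hT : IsTrajectory n m p N A B C D ud yd)
    (hL1 : 1 ≤ L) (hLN : L + n' ≤ N)
    (hPE : PersistentlyExciting m N (L + n') ud) :
    ∀ (ub : ℕ → Fin m → ℝ) (yb : ℕ → Fin p → ℝ),
      IsTrajectory n m p L A B C D ub yb ↔
      ∃ α : Fin (N - L + 1) → ℝ,
        (∀ (k : Fin L) (a : Fin m), (Hankel m N L ud).mulVec α (k, a) = ub k a) ∧
        (∀ (k : Fin L) (b : Fin p), (Hankel p N L yd).mulVec α (k, b) = yb k b) := by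
  obtain ⟨x, hx⟩ := hT
  have hnext : ∀ (α : Fin (N - L + 1) → ℝ), ∀ k < L, ∑ j, α j • x (k + 1 + j) =
      A *ᵥ (∑ j, α j • x (k + j)) + B *ᵥ (∑ j, α j • ud (k + j)) := by
    intro α k hk
    rw [← Matrix.sum_smul_mulVec_add]
    refine Finset.sum_congr rfl fun j _ => ?_
    rw [add_right_comm, (hx (k + j) (by omega)).1]
  have hout : ∀ (α : Fin (N - L + 1) → ℝ), ∀ k < L, ∑ j, α j • yd (k + j) =
      C *ᵥ (∑ j, α j • x (k + j)) + D *ᵥ (∑ j, α j • ud (k + j)) := by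
    intro α k hk
    rw [← Matrix.sum_smul_mulVec_add]
    refine Finset.sum_congr rfl fun j _ => ?_
    rw [(hx (k + j) (by omega)).2]
  intro ub yb
  constructor
  · rintro ⟨xb, hxb⟩
    obtain ⟨α, hα⟩ := surjective_state_input hctrb hn' (fun k hk => (hx k hk).1) hLN hPE
      (Sum.elim (xb 0) fun r => ub r.1 r.2)
    rw [fromRows_mulVec] at hα
    have hu : ∀ (k : Fin L) (a : Fin m), (Hankel m N L ud *ᵥ α) (k, a) = ub k a :=
      fun k a => congrFun hα (Sum.inr (k, a))
    have hux : ∀ k < L, ∑ j : Fin (N - L + 1), α j • ud (k + j) = ub k := by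
      intro k hk
      ext a
      rw [← hu ⟨k, hk⟩ a]
      simp [mulVec, dotProduct, Hankel, mul_comm]
    have hstate : ∀ k ≤ L, ∑ j : Fin (N - L + 1), α j • x (k + j) = xb k := by
      intro k
      induction k with
      | zero =>
        intro _
        ext i
        have := congrFun hα (Sum.inl i)
        simpa [mulVec, dotProduct, mul_comm] using this
      | succ k ih =>
        intro hk
        rw [(hxb k hk).1, ← ih (by omega), ← hux k hk, hnext α k hk]
    refine ⟨α, hu, fun k b => ?_⟩
    rw [(hxb k k.2).2, ← hstate k k.2.le, ← hux k k.2, ← hout α k k.2]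
    simp [mulVec, dotProduct, Hankel, mul_comm]
  · rintro ⟨α, hu, hy⟩
    refine ⟨fun k => ∑ j : Fin (N - L + 1), α j • x (k + j), fun k hk => ?_⟩
    have hux : ∑ j : Fin (N - L + 1), α j • ud (k + j) = ub k := by
      ext a
      rw [← hu ⟨k, hk⟩ a]
      simp [mulVec, dotProduct, Hankel, mul_comm]
    have hyx : ∑ j : Fin (N - L + 1), α j • yd (k + j) = yb k := by
      ext a
      rw [← hy ⟨k, hk⟩ a]
      simp [mulVec, dotProduct, Hankel, mul_comm]
    rw [← hux, ← hyx]
    exact ⟨hnext α k hk, hout α k hk⟩
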